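/- Let (A, m) be a regular Noetherian local ring with regular system of parameters x_1, …, x_r, and let B be a Noetherian local ring with a local homomorphism φ : A → B such that φ(x_1), …, φ(x_r) form part of a regular system of parameters of B. Then Tor_1^A(A/m, B) = 0, i.e. B is flat over A. -/

import Mathlib

open IsLocalRing TensorProduct

namespace IsLocalRing

theorem isLocalRing_quotient {R : Type*} [CommRing R] [IsLocalRing R] {I : Ideal R}
    (hI : I ≤ maximalIdeal R) : IsLocalRing (R ⧸ I) :=
  have : Nontrivial (R ⧸ I) := Ideal.Quotient.nontrivial_iff.mpr
    (ne_top_of_le_ne_top (maximalIdeal.isMaximal R).ne_top hI)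
  .of_surjective' (Ideal.Quotient.mk I) Ideal.Quotient.mk_surjective

theorem quotient_span_range_eq_and_ringKrullDim_eq {R ι : Type*} [CommRing R] [IsLocalRing R]
    [IsNoetherianRing R] [Fintype ι] {I : Ideal R} [IsLocalRing (R ⧸ I)] {y : R}
    (hI : I = Ideal.span {y}) (x : ι → R)
    (h : Ideal.span (insert y (Set.range x)) = maximalIdeal R)
    (hd : ringKrullDim R = ((Fintype.card ι + 1 : ℕ) : WithBot ℕ∞)) :
    Ideal.span (Set.range fun i => Ideal.Quotient.mk I (x i)) = maximalIdeal (R ⧸ I) ∧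
      ringKrullDim (R ⧸ I) = ((Fintype.card ι : ℕ) : WithBot ℕ∞) := by
  have hy : y ∈ maximalIdeal R := h ▸ Ideal.subset_span (Set.mem_insert _ _)
  have hspan : Ideal.span (Set.range fun i => Ideal.Quotient.mk I (x i)) =
      maximalIdeal (R ⧸ I) := by
    have h1 := ((local_hom_TFAE (Ideal.Quotient.mk I)).out 0 4).mp
      (IsLocalHom.of_surjective _ Ideal.Quotient.mk_surjective)
    have h2 : (maximalIdeal R).map (Ideal.Quotient.mk I) = maximalIdeal (R ⧸ I) := by
      rw [← h1, Ideal.map_comap_of_surjective _ Ideal.Quotient.mk_surjective]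
    rw [← h2, ← h, Ideal.map_span, Set.image_insert_eq, ← Set.range_comp,
      Ideal.Quotient.eq_zero_iff_mem.mpr (hI ▸ Ideal.mem_span_singleton_self y),
      Ideal.span_insert_zero]
    rfl
  refine ⟨hspan, le_antisymm ?_ ?_⟩
  · refine (ringKrullDim_le_spanFinrank_maximalIdeal _).trans ?_
    rw [← hspan]
    norm_cast
    refine (Submodule.spanFinrank_span_le_ncard_of_finite (Set.finite_range _)).trans ?_
    rw [← Set.image_univ, ← Nat.card_eq_fintype_card, ← Set.ncard_univ]
    exact Set.ncard_image_le
  · have := ringKrullDim_le_ringKrullDim_quotient_add_encard (R := R) {y}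
      (by simpa [ringJacobson_eq_maximalIdeal] using hy)
    rw [← hI, hd, Set.encard_singleton] at this
    push_cast at this
    exact (ENat.WithBot.add_le_add_one_right_iff).mp this

theorem isField_of_span_eq_of_isEmpty {R ι : Type*} [CommRing R] [IsLocalRing R] [IsEmpty ι]
    (x : ι → R) (h : Ideal.span (Set.range x) = maximalIdeal R) : IsField R := by
  rw [isField_iff_maximalIdeal_eq, ← h, Set.range_eq_empty, Ideal.span_empty]

/-- A generating family of the maximal ideal may absorb any element outside `𝔪 ^ 2`. -/
theorem exists_span_insert_eq_maximalIdeal {R : Type*} [CommRing R] [IsLocalRing R] {n : ℕ}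
    (x : Fin (n + 1) → R) (h : Ideal.span (Set.range x) = maximalIdeal R) {y : R}
    (hy : y ∈ maximalIdeal R) (hy2 : y ∉ maximalIdeal R ^ 2) :
    ∃ i, Ideal.span (insert y (Set.range (x ∘ Fin.succAbove i))) = maximalIdeal R := by
  have hxm (i) : x i ∈ maximalIdeal R := h ▸ Ideal.subset_span ⟨i, rfl⟩
  obtain ⟨a, ha⟩ := (Ideal.mem_span_range_iff_exists_fun).mp (h.symm ▸ hy)
  obtain ⟨i, hi⟩ : ∃ i, IsUnit (a i) := by
    by_contra! hcon
    refine hy2 (ha ▸ Ideal.sum_mem _ fun i _ => ?_)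
    rw [pow_two]
    exact Ideal.mul_mem_mul ((mem_maximalIdeal _).mpr (hcon i)) (hxm i)
  refine ⟨i, le_antisymm ?_ ?_⟩
  · rw [Ideal.span_le]
    rintro _ (rfl | ⟨j, rfl⟩)
    exacts [hy, hxm _]
  · rw [← h, Ideal.span_le]
    rintro _ ⟨j, rfl⟩
    set J := Ideal.span (insert y (Set.range (x ∘ Fin.succAbove i)))
    have hJ (k) : x (i.succAbove k) ∈ J := Ideal.subset_span (.inr ⟨k, rfl⟩)
    refine Fin.succAboveCases i ?_ hJ j
    rw [SetLike.mem_coe, ← J.unit_mul_mem_iff_mem hi]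
    rw [Fin.sum_univ_succAbove _ i] at ha
    rw [eq_sub_of_add_eq ha]
    exact J.sub_mem (Ideal.subset_span (.inl rfl))
      (Ideal.sum_mem _ fun k _ => J.mul_mem_left _ (hJ k))

theorem exists_mem_maximalIdeal_notMem_sq_notMem_minimalPrimes {R : Type*} [CommRing R]
    [IsLocalRing R] [IsNoetherianRing R] (hd : 0 < ringKrullDim R) :
    ∃ y ∈ maximalIdeal R, y ∉ maximalIdeal R ^ 2 ∧ ∀ p ∈ minimalPrimes R, y ∉ p := by
  classical
  by_contra! hcon
  have hfin := minimalPrimes.finite_of_isNoetherianRing R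
  have hsub : (maximalIdeal R : Set R) ⊆
      ⋃ i ∈ (↑(insert (maximalIdeal R ^ 2) hfin.toFinset) : Set (Ideal R)), (i : Set R) := by
    intro y hy
    by_cases h2 : y ∈ maximalIdeal R ^ 2
    · exact Set.mem_biUnion (by simp) h2
    · obtain ⟨p, hp, hyp⟩ := hcon y hy h2
      exact Set.mem_biUnion (by simp [hp]) hyp
  rw [Ideal.subset_union_prime (maximalIdeal R ^ 2) (maximalIdeal R ^ 2)] at hsub
  · have h0 : Ideal.height (maximalIdeal R) ≠ 0 := by
      intro h
      rw [← maximalIdeal_height_eq_ringKrullDim, h] at hd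
      simp at hd
    obtain ⟨p, hp, hle⟩ := hsub
    rcases Finset.mem_insert.mp hp with rfl | hp
    · have : maximalIdeal R = ⊥ := by
        refine Submodule.eq_bot_of_le_smul_of_le_jacobson_bot (maximalIdeal R) _
          (IsNoetherian.noetherian _) ?_ (maximalIdeal_le_jacobson _)
        rwa [smul_eq_mul, ← pow_two]
      exact h0 (by rw [this, Ideal.height_bot])
    · rw [hfin.mem_toFinset] at hp
      have := hp.1.1
      rw [(maximalIdeal.isMaximal R).eq_of_le this.ne_top hle] at h0
      exact h0 (Ideal.height_eq_zero_iff.mpr hp)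
  · intro p hp h1 _
    exact (hfin.mem_toFinset.mp ((Finset.mem_insert.mp hp).resolve_left h1)).1.1

theorem isDomain_of_span_eq_maximalIdeal {n : ℕ} {R : Type*} [CommRing R] [IsLocalRing R]
    [IsNoetherianRing R] (x : Fin n → R) (h : Ideal.span (Set.range x) = maximalIdeal R)
    (hd : ringKrullDim R = (n : WithBot ℕ∞)) : IsDomain R := by
  induction n generalizing R with
  | zero => exact (isField_of_span_eq_of_isEmpty x h).isDomain
  | succ n ih =>
    obtain ⟨y, hy, hy2, hymin⟩ := exists_mem_maximalIdeal_notMem_sq_notMem_minimalPrimes (R := R)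
      (by rw [hd]; exact_mod_cast n.succ_pos)
    obtain ⟨i, hi⟩ := exists_span_insert_eq_maximalIdeal x h hy hy2
    have : IsLocalRing (R ⧸ Ideal.span {y}) :=
      isLocalRing_quotient ((Ideal.span_singleton_le_iff_mem _).mpr hy)
    obtain ⟨h1, h2⟩ := quotient_span_range_eq_and_ringKrullDim_eq rfl _ hi (by simpa using hd)
    have := ih _ h1 (by simpa using h2)
    have hprime : (Ideal.span {y}).IsPrime := (Ideal.Quotient.isDomain_iff_prime _).mp this
    obtain ⟨q, hq, hqy⟩ := Ideal.exists_minimalPrimes_le (bot_le : ⊥ ≤ Ideal.span {y})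
    have hqprime : q.IsPrime := hq.1.1
    have : q = ⊥ := by
      refine Submodule.eq_bot_of_le_smul_of_le_jacobson_bot (Ideal.span {y}) _
        (IsNoetherian.noetherian _) (fun a ha => ?_)
        (((Ideal.span_singleton_le_iff_mem _).mpr hy).trans (maximalIdeal_le_jacobson _))
      obtain ⟨b, rfl⟩ := Ideal.mem_span_singleton.mp (hqy ha)
      exact Ideal.mul_mem_mul (Ideal.mem_span_singleton_self y)
        ((hqprime.mem_or_mem ha).resolve_left (hymin q hq))
    subst this
    exact IsDomain.of_bot_isPrime R

end IsLocalRing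

namespace Module.Flat

theorem lTensor_restrictScalars_injective_of_baseChange {R S M P Q : Type*} [CommRing R]
    [CommRing S] [Algebra R S] [AddCommGroup M] [Module R M] [AddCommGroup P] [Module R P]
    [Module S P] [IsScalarTower R S P] [AddCommGroup Q] [Module R Q] [Module S Q]
    [IsScalarTower R S Q] [Module.Flat S (S ⊗[R] M)] (f : P →ₗ[S] Q)
    (hf : Function.Injective f) :
    Function.Injective ((f.restrictScalars R).lTensor M) := by
  rw [LinearMap.lTensor_inj_iff_rTensor_inj]
  have h := rTensor_preserves_injective_linearMap (M := S ⊗[R] M) f hf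
  let eP := AlgebraTensorModule.cancelBaseChange R S S P M
  let eQ := AlgebraTensorModule.cancelBaseChange R S S Q M
  have hcomm (z : P ⊗[R] M) :
      (f.restrictScalars R).rTensor M z = eQ (f.rTensor (S ⊗[R] M) (eP.symm z)) := by
    induction z with
    | zero => simp
    | add a b ha hb => simp only [map_add, ha, hb]
    | tmul a b => simp [eP, eQ]
  intro a b hab
  simp only [hcomm] at hab
  exact eP.symm.injective (h (eQ.injective hab))

variable {A B : Type*} [CommRing A] [CommRing B] [Algebra A B] {x : A}

theorem exists_lTensor_restrict_eq_of_mem_ker (hB : IsSMulRegular B x)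
    [Module.Flat (A ⧸ Ideal.span {x}) ((A ⧸ Ideal.span {x}) ⊗[A] B)] (I : Ideal A)
    (g : Submodule.comap (LinearMap.lsmul A A x) I →ₗ[A] I) (hg : ∀ a, (g a : A) = x * a)
    (z : B ⊗[A] I) (hz : I.subtype.lTensor B z = 0) :
    ∃ w, (Submodule.subtype _).lTensor B w = 0 ∧ g.lTensor B w = z := by
  let Q := A ⧸ Ideal.span {x}
  let J : Ideal Q := I.map (Ideal.Quotient.mk _)
  let p : I →ₗ[A] J := LinearMap.codRestrict (J.restrictScalars A)
    ((Algebra.linearMap A Q).comp I.subtype) fun a => Ideal.mem_map_of_mem _ a.2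
  have hp : Function.Surjective p := by
    rintro ⟨b, hb⟩
    obtain ⟨a, ha, rfl⟩ := (Ideal.mem_map_iff_of_surjective _ Ideal.Quotient.mk_surjective).mp hb
    exact ⟨⟨a, ha⟩, rfl⟩
  have hexact : Function.Exact g p := by
    intro a
    have : p a = 0 ↔ x ∣ a := by
      rw [← Ideal.mem_span_singleton, ← Ideal.Quotient.eq_zero_iff_mem, Subtype.ext_iff]
      rfl
    rw [this]
    constructor
    · rintro ⟨b, hb⟩
      exact ⟨⟨b, show x * b ∈ I from hb ▸ a.2⟩, Subtype.ext ((hg _).trans hb.symm)⟩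
    · rintro ⟨b, rfl⟩
      exact ⟨b, hg b⟩
  have hpz : p.lTensor B z = 0 := by
    refine lTensor_restrictScalars_injective_of_baseChange (R := A) (M := B) J.subtype
      J.injective_subtype ?_
    rw [map_zero, ← LinearMap.lTensor_comp_apply]
    have : (J.subtype.restrictScalars A).comp p = (Algebra.linearMap A Q).comp I.subtype := rfl
    rw [this, LinearMap.lTensor_comp_apply, hz, map_zero]
  obtain ⟨w, rfl⟩ := (_root_.lTensor_exact B hexact hp z).mp hpz
  refine ⟨w, ?_, rfl⟩
  have hreg : IsSMulRegular (B ⊗[A] A) x :=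
    ((TensorProduct.rid A B).isSMulRegular_congr x).mpr hB
  refine hreg (?_ : x • _ = x • _)
  have : I.subtype.comp g = x • Submodule.subtype _ := LinearMap.ext hg
  rw [← LinearMap.lTensor_comp_apply, this, LinearMap.lTensor_smul, LinearMap.smul_apply] at hz
  rw [hz, smul_zero]

/-- Flatness may be tested modulo an element of the base that is regular on the target. -/
theorem of_isSMulRegular_of_baseChange_quotient [IsNoetherianRing A] [IsNoetherianRing B]
    (hx : algebraMap A B x ∈ Ring.jacobson B) (hB : IsSMulRegular B x)
    [Module.Flat (A ⧸ Ideal.span {x}) ((A ⧸ Ideal.span {x}) ⊗[A] B)] : Module.Flat A B := by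
  rw [iff_lTensor_injective']
  intro I
  induction I using IsNoetherian.induction with
  | hgt I ih =>
  rw [injective_iff_map_eq_zero]
  intro z hz
  let J : Ideal A := Submodule.comap (LinearMap.lsmul A A x) I
  have hIJ : I ≤ J := fun a ha => Ideal.mul_mem_left I x ha
  let g : J →ₗ[A] I := (LinearMap.lsmul A A x).restrict fun _ h => h
  have key := exists_lTensor_restrict_eq_of_mem_ker hB I g fun _ => rfl
  rcases hIJ.eq_or_lt with heq | hlt
  · let K : Submodule B (B ⊗[A] I) := LinearMap.ker (I.subtype.baseChange B)
    suffices K = ⊥ from (Submodule.mem_bot B).mp (this ▸ (hz : z ∈ K))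
    refine Submodule.eq_bot_of_le_smul_of_le_jacobson_bot (Ideal.span {algebraMap A B x}) _
      (IsNoetherian.noetherian _) (fun u hu => ?_)
      ((Ideal.span_singleton_le_iff_mem _).mpr (Ideal.jacobson_bot (R := B) ▸ hx))
    obtain ⟨w, hw, rfl⟩ := key u hu
    let e : J →ₗ[A] I := Submodule.inclusion heq.ge
    have hge : g = x • e := rfl
    rw [hge, LinearMap.lTensor_smul, LinearMap.smul_apply, algebra_compatible_smul B x]
    refine Submodule.smul_mem_smul (Ideal.mem_span_singleton_self _) ?_
    change I.subtype.lTensor B (e.lTensor B w) = 0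
    rw [← LinearMap.lTensor_comp_apply]
    exact hw
  · obtain ⟨w, hw, rfl⟩ := key z hz
    rw [(injective_iff_map_eq_zero _).mp (ih J hlt) w hw, map_zero]

end Module.Flat

theorem Module.Flat.of_span_eq_maximalIdeal {A B : Type*} [CommRing A] [CommRing B]
    [IsLocalRing A] [IsLocalRing B] [IsNoetherianRing A] [IsNoetherianRing B] [Algebra A B]
    {r s : ℕ} (x : Fin r → A) (y : Fin s → B)
    (hx : Ideal.span (Set.range x) = maximalIdeal A)
    (hA : ringKrullDim A = (r : WithBot ℕ∞))
    (hy : Ideal.span (Set.range (fun i => algebraMap A B (x i)) ∪ Set.range y) = maximalIdeal B)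
    (hB : ringKrullDim B = ((r + s : ℕ) : WithBot ℕ∞)) : Module.Flat A B := by
  induction r generalizing A B with
  | zero =>
    let := (isField_of_span_eq_of_isEmpty x hx).toField
    infer_instance
  | succ r ih =>
    let I := Ideal.span {x 0}
    let IB := I.map (algebraMap A B)
    have hIB : IB = Ideal.span {algebraMap A B (x 0)} := by simp [IB, I, Ideal.map_span]
    have hxA : x 0 ∈ maximalIdeal A := hx ▸ Ideal.subset_span ⟨0, rfl⟩
    have hxB : algebraMap A B (x 0) ∈ maximalIdeal B :=
      hy ▸ Ideal.subset_span (.inl ⟨0, rfl⟩)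
    have hI : I ≤ maximalIdeal A := (Ideal.span_singleton_le_iff_mem _).mpr hxA
    have hIB' : IB ≤ maximalIdeal B := hIB ▸ (Ideal.span_singleton_le_iff_mem _).mpr hxB
    have : IsLocalRing (A ⧸ I) := isLocalRing_quotient hI
    have : IsLocalRing (B ⧸ IB) := isLocalRing_quotient hIB'
    have hxs : Set.range x = insert (x 0) (Set.range fun i : Fin r => x i.succ) := by
      rw [← Fin.range_cons, ← Fin.cons_self_tail x]
      rfl
    obtain ⟨hA1, hA2⟩ := quotient_span_range_eq_and_ringKrullDim_eq (I := I) rfl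
      (fun i : Fin r => x i.succ) (hxs ▸ hx) (by simpa using hA)
    let z : Fin r ⊕ Fin s → B := Sum.elim (fun i => algebraMap A B (x i.succ)) y
    have hz : Ideal.span (insert (algebraMap A B (x 0)) (Set.range z)) = maximalIdeal B := by
      rw [← hy, Set.range_comp' (algebraMap A B) x, hxs, Set.image_insert_eq, ← Set.range_comp,
        Set.Sum.elim_range, Set.insert_union]
      rfl
    obtain ⟨hB1, hB2⟩ := quotient_span_range_eq_and_ringKrullDim_eq hIB z hz
      (by rw [hB]; congr 1; simp; omega)
    have hreg : IsSMulRegular B (x 0) := by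
      have : IsDomain B := isDomain_of_span_eq_maximalIdeal (n := r + 1 + s)
        (Sum.elim (fun i => algebraMap A B (x i)) y ∘ finSumFinEquiv.symm)
        (by rw [finSumFinEquiv.symm.surjective.range_comp, Set.Sum.elim_range, hy]) hB
      have h0 : algebraMap A B (x 0) ≠ 0 := by
        intro h0
        rw [h0, Ideal.span_singleton_eq_bot.mpr rfl] at hIB
        rw [hIB, ringKrullDim_eq_of_ringEquiv (RingEquiv.quotientBot B), hB] at hB2
        simp at hB2
        norm_cast at hB2
        omega
      intro a b hab
      simp only [Algebra.smul_def] at hab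
      exact mul_left_cancel₀ h0 hab
    have hflat : Module.Flat (A ⧸ I) (B ⧸ IB) := by
      refine ih (fun i => Ideal.Quotient.mk I (x i.succ)) (fun j => Ideal.Quotient.mk IB (y j)) hA1
        (by simpa using hA2) ?_ (by simpa using hB2)
      rw [← hB1]
      congr 1
      rw [← Set.Sum.elim_range]
      congr 1
      ext (i | j) <;> rfl
    have := Module.Flat.of_linearEquiv
      (Algebra.TensorProduct.quotIdealMapEquivQuotTensor B I).symm.toLinearEquiv
    exact Module.Flat.of_isSMulRegular_of_baseChange_quotient
      (by rwa [ringJacobson_eq_maximalIdeal]) hreg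

theorem stmt_3 (A B : Type*) [CommRing A] [CommRing B]
    [IsLocalRing A] [IsLocalRing B] [IsNoetherianRing A] [IsNoetherianRing B]
    [Algebra A B] [IsLocalHom (algebraMap A B)]
    (r : ℕ) (x : Fin r → A)
    (hx : Ideal.span (Set.range x) = IsLocalRing.maximalIdeal A)
    (hdimA : ringKrullDim A = (r : WithBot (WithTop ℕ)))
    (hB : ∃ (s : ℕ) (y : Fin s → B),
      Ideal.span (Set.range (fun i => algebraMap A B (x i)) ∪ Set.range y) =
        IsLocalRing.maximalIdeal B ∧
      ringKrullDim B = ((r + s : ℕ) : WithBot (WithTop ℕ))) :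
    Module.Flat A B := by
  obtain ⟨s, y, hy, hdimB⟩ := hB
  exact Module.Flat.of_span_eq_maximalIdeal x y hx hdimA hy hdimB
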